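/- The Fourier projection F_n is a minimal projection with respect to the numerical radius: ‖F_n‖_w ≤ ‖P‖_w for every bounded linear projection P of C(2π) onto π_n. -/

import Mathlib

open Real MeasureTheory intervalIntegral

noncomputable section

instance : Fact ((0:ℝ) < 2 * π) := ⟨by positivity⟩

/-- The circle `ℝ / 2πℤ`; continuous functions on it are exactly the continuous
`2π`-periodic real-valued functions on `ℝ`, and `C(Circ2π, ℝ)` carries the supremum norm. -/
abbrev Circ2pi : Type := AddCircle (2 * π)

theorem cos_periodic' (k : ℕ) : Function.Periodic (fun t : ℝ => cos (k * t)) (2 * π) := by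
  intro t
  show cos (k * (t + 2 * π)) = cos (k * t)
  have h : (k : ℝ) * (t + 2 * π) = k * t + (k : ℤ) * (2 * π) := by push_cast; ring
  rw [h, Real.cos_add_int_mul_two_pi]

theorem sin_periodic' (k : ℕ) : Function.Periodic (fun t : ℝ => sin (k * t)) (2 * π) := by
  intro t
  show sin (k * (t + 2 * π)) = sin (k * t)
  have h : (k : ℝ) * (t + 2 * π) = k * t + (k : ℤ) * (2 * π) := by push_cast; ring
  rw [h, Real.sin_add_int_mul_two_pi]

/-- `t ↦ cos (k t)` as an element of `C(2π)`. -/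
def cosP (k : ℕ) : C(Circ2pi, ℝ) :=
  ⟨(cos_periodic' k).lift,
   continuous_coinduced_dom.mpr (by fun_prop : Continuous fun t : ℝ => cos (k * t))⟩

/-- `t ↦ sin (k t)` as an element of `C(2π)`. -/
def sinP (k : ℕ) : C(Circ2pi, ℝ) :=
  ⟨(sin_periodic' k).lift,
   continuous_coinduced_dom.mpr (by fun_prop : Continuous fun t : ℝ => sin (k * t))⟩

theorem cosP_apply (k : ℕ) (t : ℝ) : cosP k (t : Circ2pi) = cos (k * t) :=
  (cos_periodic' k).lift_coe t

theorem sinP_apply (k : ℕ) (t : ℝ) : sinP k (t : Circ2pi) = sin (k * t) :=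
  (sin_periodic' k).lift_coe t

/-- `π_n`: the subspace of trigonometric polynomials of degree at most `n`, spanned by
`1 = cos (0 ⬝ t)`, `cos (k t)` and `sin (k t)` for `1 ≤ k ≤ n`. -/
def trigPoly (n : ℕ) : Submodule ℝ C(Circ2pi, ℝ) :=
  Submodule.span ℝ
    ((Set.range fun k : Fin (n + 1) => cosP k) ∪ (Set.range fun k : Fin n => sinP (k + 1)))

/-- Translation `(T_g f)(t) = f (t + g)` on `C(2π)`. -/
def translateC (g : ℝ) (f : C(Circ2pi, ℝ)) : C(Circ2pi, ℝ) :=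
  f.comp ⟨fun θ => θ + (g : Circ2pi), by continuity⟩

/-- `F` is the `n`-th Fourier projection `F_n`: for every `f ∈ C(2π)` and `t ∈ ℝ`,
`(F f)(t) = a₀/2 + ∑_{k=1}^n (a_k cos (k t) + b_k sin (k t))`, where
`a_k = (1/π) ∫_0^{2π} f(s) cos (k s) ds` and `b_k = (1/π) ∫_0^{2π} f(s) sin (k s) ds`. -/
def IsFourierProjection (n : ℕ) (F : C(Circ2pi, ℝ) →L[ℝ] C(Circ2pi, ℝ)) : Prop :=
  ∀ (f : C(Circ2pi, ℝ)) (t : ℝ),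
    F f (t : Circ2pi) =
      1 / (2 * π) * (∫ s in (0:ℝ)..(2 * π), f (s : Circ2pi)) +
      ∑ k ∈ Finset.Icc 1 n,
        ((1 / π * ∫ s in (0:ℝ)..(2 * π), f (s : Circ2pi) * cos (k * s)) * cos (k * t) +
         (1 / π * ∫ s in (0:ℝ)..(2 * π), f (s : Circ2pi) * sin (k * s)) * sin (k * t))

/-- The numerical radius of a bounded linear operator `L` on `X`:
`‖L‖_w = sup { |x*(L x)| : ‖x‖ = ‖x*‖ = 1, x*(x) = 1 }`. -/
def numericalRadius {𝕜 : Type*} [RCLike 𝕜] {X : Type*} [NormedAddCommGroup X]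
    [NormedSpace 𝕜 X] (L : X →L[𝕜] X) : ℝ :=
  sSup {r : ℝ | ∃ (x : X) (f : X →L[𝕜] 𝕜), ‖x‖ = 1 ∧ ‖f‖ = 1 ∧ f x = 1 ∧ r = ‖f (L x)‖}

/-- `t ↦ cos (k t + a)` as an element of `C(2π)`. -/
def phaseCos (k : ℕ) (a : ℝ) : C(Circ2pi, ℝ) := cos a • cosP k - sin a • sinP k

theorem phaseCos_apply (k : ℕ) (a t : ℝ) : phaseCos k a (t : Circ2pi) = cos (k * t + a) := by
  simp only [phaseCos, ContinuousMap.sub_apply, ContinuousMap.smul_apply, smul_eq_mul, cosP_apply,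
    sinP_apply, cos_add]
  ring

theorem circ2pi_ext {f g : C(Circ2pi, ℝ)} (h : ∀ t : ℝ, f (t : Circ2pi) = g (t : Circ2pi)) :
    f = g := by
  ext x
  induction x using QuotientAddGroup.induction_on with
  | H t => exact h t

theorem phaseCos_zero (k : ℕ) : phaseCos k 0 = cosP k := by simp [phaseCos]

theorem phaseCos_neg_pi_div_two (k : ℕ) : phaseCos k (-(π / 2)) = sinP k := by simp [phaseCos]

theorem phaseCos_mem_trigPoly {n k : ℕ} (hk : k ≤ n) (a : ℝ) : phaseCos k a ∈ trigPoly n := by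
  refine Submodule.sub_mem _ (Submodule.smul_mem _ _ ?_) (Submodule.smul_mem _ _ ?_)
  · exact Submodule.subset_span (Or.inl ⟨⟨k, by omega⟩, rfl⟩)
  · cases k with
    | zero =>
      have : sinP 0 = 0 := circ2pi_ext fun t => by simp [sinP_apply]
      rw [this]
      exact Submodule.zero_mem _
    | succ k => exact Submodule.subset_span (Or.inr ⟨⟨k, by omega⟩, rfl⟩)

theorem trigPoly_induction {n : ℕ} {p : C(Circ2pi, ℝ) → Prop}
    (h_phase : ∀ k ≤ n, ∀ a, p (phaseCos k a)) (h_add : ∀ u v, p u → p v → p (u + v))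
    (h_smul : ∀ (c : ℝ) u, p u → p (c • u)) {u : C(Circ2pi, ℝ)} (hu : u ∈ trigPoly n) : p u := by
  induction hu using Submodule.span_induction with
  | mem u hu =>
    rcases hu with ⟨k, rfl⟩ | ⟨k, rfl⟩
    · simpa only [phaseCos_zero] using h_phase k (by omega) 0
    · simpa only [phaseCos_neg_pi_div_two] using h_phase (k + 1) (by omega) (-(π / 2))
  | zero => simpa using h_smul 0 _ (h_phase 0 (Nat.zero_le n) 0)
  | add u v _ _ hu hv => exact h_add u v hu hv
  | smul c u _ hu => exact h_smul c u hu

/-- The union of all `π_n`. -/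
def allTrigPoly : Submodule ℝ C(Circ2pi, ℝ) :=
  Submodule.span ℝ (Set.range fun p : ℕ × ℝ => phaseCos p.1 p.2)

theorem mem_allTrigPoly_of_eq_cos (m : ℤ) (a : ℝ) {f : C(Circ2pi, ℝ)}
    (hf : ∀ t : ℝ, f (t : Circ2pi) = cos (m * t + a)) : f ∈ allTrigPoly := by
  rcases Int.eq_nat_or_neg m with ⟨k, rfl | rfl⟩
  · refine Submodule.subset_span ⟨(k, a), circ2pi_ext fun t => ?_⟩
    simp [phaseCos_apply, hf]
  · refine Submodule.subset_span ⟨(k, -a), circ2pi_ext fun t => ?_⟩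
    rw [phaseCos_apply, hf, ← cos_neg]
    congr 1
    push_cast
    ring

theorem re_im_mem_allTrigPoly {p : C(Circ2pi, ℂ)}
    (hp : p ∈ Submodule.span ℂ (Set.range (@fourier (2 * π)))) :
    Complex.reCLM.compLeftContinuous ℝ Circ2pi p ∈ allTrigPoly ∧
      Complex.imCLM.compLeftContinuous ℝ Circ2pi p ∈ allTrigPoly := by
  induction hp using Submodule.span_induction with
  | mem p hp =>
    obtain ⟨m, rfl⟩ := hp
    have key (t : ℝ) : fourier m (t : Circ2pi) = Complex.exp ((m * t : ℝ) * Complex.I) := by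
      rw [fourier_coe_apply]
      congr 1
      have : (π : ℂ) ≠ 0 := by exact_mod_cast pi_ne_zero
      push_cast
      field_simp
    constructor
    · refine mem_allTrigPoly_of_eq_cos m 0 fun t => ?_
      change (fourier m (t : Circ2pi)).re = _
      rw [key, Complex.exp_ofReal_mul_I_re, add_zero]
    · refine mem_allTrigPoly_of_eq_cos m (-(π / 2)) fun t => ?_
      change (fourier m (t : Circ2pi)).im = _
      rw [key, Complex.exp_ofReal_mul_I_im, ← sub_eq_add_neg, cos_sub_pi_div_two]
  | zero => simp
  | add p q _ _ hp hq =>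
    rw [map_add, map_add]
    exact ⟨add_mem hp.1 hq.1, add_mem hp.2 hq.2⟩
  | smul c p _ hp =>
    have hre : Complex.reCLM.compLeftContinuous ℝ Circ2pi (c • p) =
        c.re • Complex.reCLM.compLeftContinuous ℝ Circ2pi p -
          c.im • Complex.imCLM.compLeftContinuous ℝ Circ2pi p := by
      ext x; simp
    have him : Complex.imCLM.compLeftContinuous ℝ Circ2pi (c • p) =
        c.re • Complex.imCLM.compLeftContinuous ℝ Circ2pi p +
          c.im • Complex.reCLM.compLeftContinuous ℝ Circ2pi p := by
      ext x; simp
    rw [hre, him]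
    exact ⟨sub_mem (Submodule.smul_mem _ _ hp.1) (Submodule.smul_mem _ _ hp.2),
      add_mem (Submodule.smul_mem _ _ hp.2) (Submodule.smul_mem _ _ hp.1)⟩

theorem exists_allTrigPoly_norm_sub_lt (f : C(Circ2pi, ℝ)) {ε : ℝ} (hε : 0 < ε) :
    ∃ y ∈ allTrigPoly, ‖f - y‖ < ε := by
  let fc : C(Circ2pi, ℂ) := Complex.ofRealCLM.compLeftContinuous ℝ Circ2pi f
  have hfc : fc ∈ (Submodule.span ℂ (Set.range (@fourier (2 * π)))).topologicalClosure := by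
    rw [span_fourier_closure_eq_top]
    trivial
  obtain ⟨p, hp, hd⟩ := Metric.mem_closure_iff.mp hfc ε hε
  refine ⟨_, (re_im_mem_allTrigPoly hp).1, lt_of_le_of_lt ?_ (dist_eq_norm fc p ▸ hd)⟩
  refine (ContinuousMap.norm_le _ (norm_nonneg _)).mpr fun x => ?_
  refine le_trans ?_ ((fc - p).norm_coe_le_norm x)
  have : (f - Complex.reCLM.compLeftContinuous ℝ Circ2pi p) x = ((fc - p) x).re := by simp [fc]
  rw [this]
  exact Complex.abs_re_le_norm _

/-- Translation `T_g` as an isometric automorphism of `C(2π)`. -/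
def translateIso (g : ℝ) : C(Circ2pi, ℝ) ≃ₗᵢ[ℝ] C(Circ2pi, ℝ) where
  toFun := translateC g
  invFun := translateC (-g)
  map_add' _ _ := rfl
  map_smul' _ _ := rfl
  left_inv f := by ext x; simp [translateC]
  right_inv f := by ext x; simp [translateC]
  norm_map' f := by
    have hle (g : ℝ) (f : C(Circ2pi, ℝ)) : ‖translateC g f‖ ≤ ‖f‖ :=
      (ContinuousMap.norm_le _ (norm_nonneg _)).mpr fun x => f.norm_coe_le_norm _
    refine le_antisymm (hle g f) ?_
    have h : translateC (-g) (translateC g f) = f := by ext x; simp [translateC]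
    exact (congrArg norm h).symm.trans_le (hle (-g) _)

theorem translateIso_coe (g : ℝ) (f : C(Circ2pi, ℝ)) (t : ℝ) :
    translateIso g f (t : Circ2pi) = f ((t + g : ℝ) : Circ2pi) := rfl

theorem translateIso_symm_coe (g : ℝ) (f : C(Circ2pi, ℝ)) (t : ℝ) :
    (translateIso g).symm f (t : Circ2pi) = f ((t - g : ℝ) : Circ2pi) := by
  rw [sub_eq_add_neg]
  rfl

theorem translateIso_phaseCos (g : ℝ) (k : ℕ) (a : ℝ) :
    translateIso g (phaseCos k a) = phaseCos k (a + k * g) := by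
  refine circ2pi_ext fun t => ?_
  rw [translateIso_coe, phaseCos_apply, phaseCos_apply]
  congr 1
  ring

section NumericalRadius

variable {X : Type*} [NormedAddCommGroup X] [NormedSpace ℝ X]

theorem norm_apply_le_numericalRadius (L : X →L[ℝ] X) {x : X} {f : X →L[ℝ] ℝ}
    (hx : ‖x‖ = 1) (hf : ‖f‖ = 1) (hfx : f x = 1) : ‖f (L x)‖ ≤ numericalRadius L := by
  refine le_csSup ⟨‖L‖, ?_⟩ ⟨x, f, hx, hf, hfx, rfl⟩
  rintro r ⟨y, h, hy, hh, -, rfl⟩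
  calc ‖h (L y)‖ ≤ ‖h‖ * (‖L‖ * ‖y‖) := h.le_opNorm_of_le (L.le_opNorm y)
    _ = ‖L‖ := by rw [hy, hh, one_mul, mul_one]

theorem norm_apply_conj_le_numericalRadius (L : X →L[ℝ] X) (T : X ≃ₗᵢ[ℝ] X) {x : X}
    {f : X →L[ℝ] ℝ} (hx : ‖x‖ = 1) (hf : ‖f‖ = 1) (hfx : f x = 1) :
    ‖f (T.symm (L (T x)))‖ ≤ numericalRadius L := by
  refine norm_apply_le_numericalRadius L (x := T x)
    (f := f.comp (T.symm.toContinuousLinearEquiv : X →L[ℝ] X)) ?_ ?_ ?_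
  · rw [T.norm_map, hx]
  · exact (f.opNorm_comp_linearIsometryEquiv T.symm).trans hf
  · simpa using hfx

end NumericalRadius

theorem sum_cos_two_pi_mul_div {M : ℕ} {m : ℤ} (hm : ¬ (M : ℤ) ∣ m) (b : ℝ) :
    ∑ i ∈ Finset.range M, cos (m * (2 * π * i / M) + b) = 0 := by
  rcases Nat.eq_zero_or_pos M with rfl | hM
  · simp
  have hM' : (M : ℂ) ≠ 0 := by exact_mod_cast hM.ne'
  have hpi : (π : ℂ) ≠ 0 := by exact_mod_cast pi_ne_zero
  set z : ℂ := Complex.exp (m * (2 * π * Complex.I / M)) with hz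
  have hz1 : z ≠ 1 := by
    intro h
    obtain ⟨j, hj⟩ := Complex.exp_eq_one_iff.mp h
    refine hm ⟨j, ?_⟩
    have h2 : (m : ℂ) = M * j := by
      have hI := Complex.I_ne_zero
      field_simp at hj
      exact hj
    exact_mod_cast h2
  have hzM : z ^ M = 1 := by
    rw [hz, ← Complex.exp_nat_mul]
    refine Complex.exp_eq_one_iff.mpr ⟨m, ?_⟩
    field_simp
  have hsum : ∑ i ∈ Finset.range M, z ^ i = 0 := by rw [geom_sum_eq hz1, hzM]; simp
  have hcos (i : ℕ) : cos (m * (2 * π * i / M) + b) = (z ^ i * Complex.exp (b * Complex.I)).re := by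
    rw [hz, ← Complex.exp_nat_mul, ← Complex.exp_add, ← Complex.exp_ofReal_mul_I_re]
    congr 2
    push_cast
    ring
  simp_rw [hcos]
  rw [← Complex.re_sum, ← Finset.sum_mul, hsum]
  simp

theorem sum_cos_smul_translate_eq_zero {n k M : ℕ} (hk : n < k) (hM : k + n < M) (a : ℝ)
    {u : C(Circ2pi, ℝ)} (hu : u ∈ trigPoly n) :
    ∑ i ∈ Finset.range M, cos (a + k * (2 * π * i / M)) •
      (translateIso (2 * π * i / M)).symm u = 0 := by
  refine trigPoly_induction (p := fun u => ∑ i ∈ Finset.range M, cos (a + k * (2 * π * i / M)) •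
    (translateIso (2 * π * i / M)).symm u = 0) (fun j hj b => ?_) (fun u v hu hv => ?_)
    (fun c u hu => ?_) hu
  · refine circ2pi_ext fun t => ?_
    have hterm (i : ℕ) : cos (a + k * (2 * π * i / M)) * cos (j * (t - 2 * π * i / M) + b) =
        2⁻¹ * (cos ((k + j : ℤ) * (2 * π * i / M) + (a - j * t - b)) +
          cos ((k - j : ℤ) * (2 * π * i / M) + (a + j * t + b))) := by
      have h := two_mul_cos_mul_cos (a + k * (2 * π * i / M)) (j * (t - 2 * π * i / M) + b)
      rw [show ((k + j : ℤ) : ℝ) * (2 * π * i / M) + (a - j * t - b) =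
          a + k * (2 * π * i / M) - (j * (t - 2 * π * i / M) + b) by push_cast; ring,
        show ((k - j : ℤ) : ℝ) * (2 * π * i / M) + (a + j * t + b) =
          a + k * (2 * π * i / M) + (j * (t - 2 * π * i / M) + b) by push_cast; ring]
      linarith
    simp only [ContinuousMap.sum_apply, ContinuousMap.smul_apply, smul_eq_mul,
      translateIso_symm_coe, phaseCos_apply, ContinuousMap.zero_apply]
    simp_rw [hterm]
    rw [← Finset.mul_sum, Finset.sum_add_distrib, sum_cos_two_pi_mul_div, sum_cos_two_pi_mul_div]
    · simp
    · intro h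
      have := Int.le_of_dvd (by omega) h
      omega
    · intro h
      have := Int.le_of_dvd (by omega) h
      omega
  · simp only [map_add, smul_add, Finset.sum_add_distrib, hu, hv, add_zero]
  · simp only [map_smul, smul_comm _ c]
    rw [← Finset.smul_sum, hu, smul_zero]

theorem integral_cos_int_mul_add (m : ℤ) (b : ℝ) :
    ∫ s in (0 : ℝ)..(2 * π), cos (m * s + b) = if m = 0 then 2 * π * cos b else 0 := by
  split_ifs with h
  · simp [h]
  · have hm : (m : ℝ) ≠ 0 := by exact_mod_cast h
    rw [integral_comp_mul_add (f := fun s => cos s) hm, integral_cos,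
      show (m : ℝ) * (2 * π) + b = b + m * (2 * π) by ring, sin_add_int_mul_two_pi]
    simp

theorem integral_cos_mul_cos_sub (k : ℕ) {j : ℕ} (hj : 1 ≤ j) (a t : ℝ) :
    ∫ s in (0 : ℝ)..(2 * π), cos (k * s + a) * cos (j * (s - t)) =
      if j = k then π * cos (k * t + a) else 0 := by
  have hterm (s : ℝ) : cos (k * s + a) * cos (j * (s - t)) =
      2⁻¹ * (cos ((k - j : ℤ) * s + (a + j * t)) + cos ((k + j : ℤ) * s + (a - j * t))) := by
    have h := two_mul_cos_mul_cos (k * s + a) (j * (s - t))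
    rw [show ((k - j : ℤ) : ℝ) * s + (a + j * t) = k * s + a - j * (s - t) by push_cast; ring,
      show ((k + j : ℤ) : ℝ) * s + (a - j * t) = k * s + a + j * (s - t) by push_cast; ring]
    linarith
  simp_rw [hterm]
  rw [intervalIntegral.integral_const_mul, intervalIntegral.integral_add
    (Continuous.intervalIntegrable (by fun_prop) _ _)
    (Continuous.intervalIntegrable (by fun_prop) _ _),
    integral_cos_int_mul_add, integral_cos_int_mul_add, if_neg (by omega : ¬ (k + j : ℤ) = 0)]
  by_cases h : j = k
  · subst h
    rw [if_pos (sub_self _), if_pos rfl, add_comm a]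
    ring
  · rw [if_neg (by omega), if_neg h]
    ring

theorem IsFourierProjection.apply_eq {n : ℕ} {F : C(Circ2pi, ℝ) →L[ℝ] C(Circ2pi, ℝ)}
    (hF : IsFourierProjection n F) (f : C(Circ2pi, ℝ)) (t : ℝ) :
    F f (t : Circ2pi) = 1 / (2 * π) * (∫ s in (0:ℝ)..(2 * π), f (s : Circ2pi)) +
      ∑ j ∈ Finset.Icc 1 n,
        1 / π * ∫ s in (0:ℝ)..(2 * π), f (s : Circ2pi) * cos (j * (s - t)) := by
  have hf : Continuous fun s : ℝ => f (s : Circ2pi) :=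
    f.continuous.comp (AddCircle.continuous_mk' (2 * π))
  rw [hF f t]
  congr 1
  refine Finset.sum_congr rfl fun j _ => ?_
  have hterm (s : ℝ) : f (s : Circ2pi) * cos (j * (s - t)) =
      f (s : Circ2pi) * cos (j * s) * cos (j * t) +
        f (s : Circ2pi) * sin (j * s) * sin (j * t) := by
    rw [mul_sub, cos_sub]
    ring
  simp_rw [hterm]
  rw [intervalIntegral.integral_add (Continuous.intervalIntegrable (by fun_prop) _ _)
    (Continuous.intervalIntegrable (by fun_prop) _ _), intervalIntegral.integral_mul_const,
    intervalIntegral.integral_mul_const]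
  ring

theorem IsFourierProjection.apply_phaseCos {n : ℕ} {F : C(Circ2pi, ℝ) →L[ℝ] C(Circ2pi, ℝ)}
    (hF : IsFourierProjection n F) (k : ℕ) (a : ℝ) :
    F (phaseCos k a) = if k ≤ n then phaseCos k a else 0 := by
  refine circ2pi_ext fun t => ?_
  rw [hF.apply_eq]
  simp_rw [phaseCos_apply]
  rw [Finset.sum_congr rfl fun j hj => by
    rw [integral_cos_mul_cos_sub k (Finset.mem_Icc.mp hj).1 a t]]
  have h0 := integral_cos_int_mul_add k a
  rw [Int.cast_natCast] at h0
  rw [h0, ← Finset.mul_sum, Finset.sum_ite_eq']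
  have hpi := pi_ne_zero
  by_cases hkn : k ≤ n
  · rcases Nat.eq_zero_or_pos k with rfl | hk
    · simp [phaseCos_apply]
      field_simp
    · rw [if_neg (by omega), if_pos (Finset.mem_Icc.mpr ⟨hk, hkn⟩), if_pos hkn, phaseCos_apply]
      field_simp
      ring
  · rw [if_neg (by omega), if_neg (by simp [hkn]), if_neg hkn]
    simp

/-- The average of the conjugates of `P` by `M` equally spaced translations. -/
def translateAverage (M : ℕ) (P : C(Circ2pi, ℝ) →L[ℝ] C(Circ2pi, ℝ)) (x : C(Circ2pi, ℝ)) :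
    C(Circ2pi, ℝ) :=
  (M : ℝ)⁻¹ • ∑ i ∈ Finset.range M,
    (translateIso (2 * π * i / M)).symm (P (translateIso (2 * π * i / M) x))

theorem translateAverage_add (M : ℕ) (P : C(Circ2pi, ℝ) →L[ℝ] C(Circ2pi, ℝ))
    (x y : C(Circ2pi, ℝ)) :
    translateAverage M P (x + y) = translateAverage M P x + translateAverage M P y := by
  simp only [translateAverage, map_add, Finset.sum_add_distrib, smul_add]

theorem translateAverage_smul (M : ℕ) (P : C(Circ2pi, ℝ) →L[ℝ] C(Circ2pi, ℝ))
    (c : ℝ) (x : C(Circ2pi, ℝ)) :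
    translateAverage M P (c • x) = c • translateAverage M P x := by
  simp only [translateAverage, map_smul, ← Finset.smul_sum]
  rw [smul_comm]

theorem norm_apply_translateAverage_le (M : ℕ) (P : C(Circ2pi, ℝ) →L[ℝ] C(Circ2pi, ℝ))
    (f : C(Circ2pi, ℝ) →L[ℝ] ℝ) (x : C(Circ2pi, ℝ)) {C : ℝ} (hC : 0 ≤ C)
    (h : ∀ g, ‖f ((translateIso g).symm (P (translateIso g x)))‖ ≤ C) :
    ‖f (translateAverage M P x)‖ ≤ C := by
  rcases Nat.eq_zero_or_pos M with rfl | hM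
  · simpa [translateAverage] using hC
  have hM' : (0 : ℝ) < M := by exact_mod_cast hM
  rw [translateAverage, map_smul, map_sum, norm_smul, norm_inv, Real.norm_natCast,
    inv_mul_le_iff₀ hM']
  refine (norm_sum_le_of_le _ fun i _ => h _).trans_eq ?_
  simp

theorem translateAverage_phaseCos {n k M : ℕ} (hM : k + n < M)
    {P : C(Circ2pi, ℝ) →L[ℝ] C(Circ2pi, ℝ)} (hP : ∀ f, P f ∈ trigPoly n)
    (hPv : ∀ v ∈ trigPoly n, P v = v) (a : ℝ) :
    translateAverage M P (phaseCos k a) = if k ≤ n then phaseCos k a else 0 := by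
  have hM' : (M : ℝ) ≠ 0 := by exact_mod_cast (by omega : M ≠ 0)
  unfold translateAverage
  split_ifs with hkn
  · have hterm (g : ℝ) : (translateIso g).symm (P (translateIso g (phaseCos k a))) =
        phaseCos k a := by
      rw [hPv _ (by rw [translateIso_phaseCos]; exact phaseCos_mem_trigPoly hkn _),
        LinearIsometryEquiv.symm_apply_apply]
    simp_rw [hterm]
    rw [Finset.sum_const, Finset.card_range, ← Nat.cast_smul_eq_nsmul ℝ, inv_smul_smul₀ hM']
  · have hterm (g : ℝ) : (translateIso g).symm (P (translateIso g (phaseCos k a))) =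
        cos (a + k * g) • (translateIso g).symm (P (cosP k)) +
          cos (a + π / 2 + k * g) • (translateIso g).symm (P (sinP k)) := by
      rw [translateIso_phaseCos, phaseCos, add_right_comm, cos_add_pi_div_two, map_sub, map_smul,
        map_smul, map_sub, map_smul, map_smul, neg_smul, sub_eq_add_neg]
    simp_rw [hterm]
    rw [Finset.sum_add_distrib, sum_cos_smul_translate_eq_zero (by omega) hM _ (hP _),
      sum_cos_smul_translate_eq_zero (by omega) hM _ (hP _), add_zero, smul_zero]

theorem IsFourierProjection.eventually_translateAverage_eq {n : ℕ}
    {F P : C(Circ2pi, ℝ) →L[ℝ] C(Circ2pi, ℝ)} (hF : IsFourierProjection n F)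
    (hP : ∀ f, P f ∈ trigPoly n) (hPv : ∀ v ∈ trigPoly n, P v = v)
    {y : C(Circ2pi, ℝ)} (hy : y ∈ allTrigPoly) :
    ∀ᶠ M in Filter.atTop, translateAverage M P y = F y := by
  induction hy using Submodule.span_induction with
  | mem y hy =>
    obtain ⟨⟨k, a⟩, rfl⟩ := hy
    filter_upwards [Filter.eventually_gt_atTop (k + n)] with M hM
    rw [translateAverage_phaseCos hM hP hPv, hF.apply_phaseCos]
  | zero => exact Filter.Eventually.of_forall fun M => by simp [translateAverage]
  | add u v _ _ hu hv =>
    filter_upwards [hu, hv] with M hu hv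
    rw [translateAverage_add, hu, hv, map_add]
  | smul c u _ hu =>
    filter_upwards [hu] with M hu
    rw [translateAverage_smul, hu, map_smul]

/-- The Fourier projection `F_n` is a minimal projection of `C(2π)` onto `π_n` with respect
to the numerical radius: `‖F_n‖_w ≤ ‖P‖_w` for every bounded linear projection `P` of
`C(2π)` onto `π_n`. -/
theorem fourierProjection_numericalRadius_minimal (n : ℕ) (hn : 1 ≤ n)
    (F : C(Circ2pi, ℝ) →L[ℝ] C(Circ2pi, ℝ)) (hF : IsFourierProjection n F) :
    ∀ P : C(Circ2pi, ℝ) →L[ℝ] C(Circ2pi, ℝ),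
      (∀ f : C(Circ2pi, ℝ), P f ∈ trigPoly n) → (∀ v ∈ trigPoly n, P v = v) →
      numericalRadius F ≤ numericalRadius P := by
  intro P hP hPv
  have hw : 0 ≤ numericalRadius P := by
    refine Real.sSup_nonneg ?_
    rintro r ⟨x, f, -, -, -, rfl⟩
    exact norm_nonneg _
  refine Real.sSup_le ?_ hw
  rintro r ⟨x, f, hx, hf, hfx, rfl⟩
  refine le_of_forall_pos_le_add fun ε hε => ?_
  have hC : 0 < ‖F‖ + ‖P‖ + 1 := by positivity
  obtain ⟨y, hy, hxy⟩ := exists_allTrigPoly_norm_sub_lt x (div_pos hε hC)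
  obtain ⟨M, hM⟩ := (hF.eventually_translateAverage_eq hP hPv hy).exists
  have hdecomp : F x = translateAverage M P x + (F (x - y) - translateAverage M P (x - y)) := by
    have h := translateAverage_add M P (x - y) y
    rw [sub_add_cancel, hM] at h
    rw [h, map_sub]
    abel
  have h1 : ‖f (translateAverage M P x)‖ ≤ numericalRadius P :=
    norm_apply_translateAverage_le M P f x hw fun g =>
      norm_apply_conj_le_numericalRadius P (translateIso g) hx hf hfx
  have h2 : ‖f (F (x - y))‖ ≤ ‖F‖ * ‖x - y‖ := by
    simpa [hf] using f.le_opNorm_of_le (F.le_opNorm (x - y))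
  have h3 : ‖f (translateAverage M P (x - y))‖ ≤ ‖P‖ * ‖x - y‖ := by
    refine norm_apply_translateAverage_le M P f _ (by positivity) fun g => ?_
    refine (f.le_opNorm _).trans ?_
    rw [hf, one_mul, LinearIsometryEquiv.norm_map]
    exact (P.le_opNorm _).trans_eq (by rw [LinearIsometryEquiv.norm_map])
  have h4 : (‖F‖ + ‖P‖ + 1) * ‖x - y‖ ≤ ε := by
    rw [mul_comm]
    exact ((lt_div_iff₀ hC).mp hxy).le
  rw [hdecomp, map_add, map_sub]
  have h5 := norm_add_le (f (translateAverage M P x))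
    (f (F (x - y)) - f (translateAverage M P (x - y)))
  have h6 := norm_sub_le (f (F (x - y))) (f (translateAverage M P (x - y)))
  nlinarith [norm_nonneg (x - y)]
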